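/- Assume conditions (C), (D1), (D2), (E1) and (E2), and extend g_n and h_n to the closed complex unit disk by ĝ_n(z) = ∑_{i=0}^∞ p_n(i) z^i and ĥ_n(z) = ∑_{i=0}^∞ q_n(i) z^i for |z| ≤ 1. Then for every fixed λ ∈ ℝ, as n → ∞: n ( e^{−iλ/c_n} ĝ_n( e^{iλ/c_n} ) − 1 ) → 0 and √n ( ĥ_n( e^{iλ/c_n} ) − 1 ) → i ω √γ₀ λ (limits in ℂ). -/

import Mathlib

open MeasureTheory Filter Topology

/-- The probability generating function of an `ℕ`-valued distribution `p`. -/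
noncomputable def pgf (p : ℕ → ℝ) (s : ℝ) : ℝ := ∑' i, p i * s ^ i

/-- The extension `ĝ(z) = ∑ p i zⁱ` of the generating function to the complex unit disk. -/
noncomputable def cpgf (p : ℕ → ℝ) (z : ℂ) : ℂ := ∑' i, (p i : ℂ) * z ^ i

/-- The mean `g'(1) = ∑ i * p i` of an `ℕ`-valued distribution `p`. -/
noncomputable def pgfMean (p : ℕ → ℝ) : ℝ := ∑' i : ℕ, (i : ℝ) * p i

/-- `G_n(λ) = n² [(1 − m_n λ/c_n) − g_n(1 − λ/c_n)]`. -/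
noncomputable def Gseq (p : ℕ → ℕ → ℝ) (c : ℕ → ℝ) (n : ℕ) (l : ℝ) : ℝ :=
  (n : ℝ) ^ 2 * ((1 - pgfMean (p n) * l / c n) - pgf (p n) (1 - l / c n))

/-- `H_n(λ) = n [(1 − ω_n λ/c_n) − h_n(1 − λ/c_n)]`. -/
noncomputable def Hseq (q : ℕ → ℕ → ℝ) (c : ℕ → ℝ) (n : ℕ) (l : ℝ) : ℝ :=
  (n : ℝ) * ((1 - pgfMean (q n) * l / c n) - pgf (q n) (1 - l / c n))

lemma div_le_bernoulli_remainder {x : ℝ} (hx0 : 0 ≤ x) (hx1 : x ≤ 1) (i : ℕ) :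
    (i : ℝ) * (i - 1) * x ^ 2 / (2 * (1 + i * x)) ≤ (1 - x) ^ i - 1 + i * x := by
  induction i with
  | zero => simp
  | succ i ih =>
    have hi : (0 : ℝ) ≤ i := Nat.cast_nonneg i
    have hix : (0 : ℝ) ≤ i * x := by positivity
    have hpow : (1 - x) ^ i * (1 + i * x) ≤ 1 := by
      have h1 : 1 + (i : ℝ) * x ≤ (1 + x) ^ i := one_add_mul_le_pow (by linarith) i
      have h2 : (0 : ℝ) ≤ (1 - x) ^ i := pow_nonneg (by linarith) i
      calc (1 - x) ^ i * (1 + i * x) ≤ (1 - x) ^ i * (1 + x) ^ i := by gcongr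
        _ = (1 - x ^ 2) ^ i := by rw [← mul_pow]; ring
        _ ≤ 1 := pow_le_one₀ (by nlinarith) (by nlinarith)
    have hstep : (i : ℝ) * x / (1 + i * x) ≤ 1 - (1 - x) ^ i := by
      rw [div_le_iff₀ (by positivity)]
      linarith
    push_cast
    have hmono : ((i : ℝ) + 1) * (i + 1 - 1) * x ^ 2 / (2 * (1 + (i + 1) * x)) ≤
        (i : ℝ) * (i - 1) * x ^ 2 / (2 * (1 + i * x)) + x * (i * x / (1 + i * x)) := by
      calc ((i : ℝ) + 1) * (i + 1 - 1) * x ^ 2 / (2 * (1 + (i + 1) * x))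
          ≤ ((i : ℝ) + 1) * (i + 1 - 1) * x ^ 2 / (2 * (1 + i * x)) := by
            apply div_le_div_of_nonneg_left
            · rw [add_sub_cancel_right]; positivity
            · positivity
            · nlinarith
        _ = _ := by field_simp; ring
    have := mul_le_mul_of_nonneg_left hstep hx0
    calc _ ≤ _ := hmono
      _ ≤ (1 - x) ^ i - 1 + i * x + x * (1 - (1 - x) ^ i) := add_le_add ih this
      _ = _ := by ring

lemma norm_exp_I_mul_sub_one_sub_le_two_mul_abs (u : ℝ) :
    ‖Complex.exp (Complex.I * u) - 1 - Complex.I * u‖ ≤ 2 * |u| := by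
  have h1 : ‖Complex.exp (Complex.I * u) - 1‖ ≤ |u| := by
    simpa using Real.norm_exp_I_mul_ofReal_sub_one_le (x := u)
  have h2 : ‖Complex.I * (u : ℂ)‖ = |u| := by simp
  linarith [norm_sub_le (Complex.exp (Complex.I * u) - 1) (Complex.I * u)]

lemma norm_exp_I_mul_sub_one_sub_le_two_mul_sq (u : ℝ) :
    ‖Complex.exp (Complex.I * u) - 1 - Complex.I * u‖ ≤ 2 * u ^ 2 := by
  rcases le_total |u| 1 with h | h
  · have h2 : ‖Complex.I * (u : ℂ)‖ = |u| := by simp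
    have := Complex.norm_exp_sub_one_sub_id_le (x := Complex.I * u) (by rwa [h2])
    rw [h2, sq_abs] at this
    nlinarith [sq_nonneg u]
  · have := norm_exp_I_mul_sub_one_sub_le_two_mul_abs u
    nlinarith [sq_abs u]

lemma norm_exp_I_mul_sub_one_sub_le_div (l : ℝ) {t : ℝ} (ht : 0 ≤ t) :
    ‖Complex.exp (Complex.I * (l * t : ℝ)) - 1 - Complex.I * (l * t : ℝ)‖ ≤
      (2 * l ^ 2 + 2 * |l|) * (t ^ 2 / (1 + t)) := by
  have h1 := norm_exp_I_mul_sub_one_sub_le_two_mul_abs (l * t)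
  have h2 := norm_exp_I_mul_sub_one_sub_le_two_mul_sq (l * t)
  rw [abs_mul, abs_of_nonneg ht] at h1
  rw [← mul_div_assoc, le_div_iff₀ (by positivity)]
  nlinarith [mul_le_mul_of_nonneg_right h1 ht]

lemma norm_exp_centered_remainder_le (l : ℝ) {x : ℝ} (hx0 : 0 ≤ x) (hx1 : x ≤ 1) (i : ℕ) :
    ‖Complex.exp (Complex.I * (l * x * (i - 1) : ℝ)) - 1 - Complex.I * (l * x * (i - 1) : ℝ)‖ ≤
      (2 * (2 * l ^ 2 + 2 * |l|) + 8 * l ^ 2) * ((1 - x) ^ i - 1 + i * x) -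
        2 * l ^ 2 * x ^ 2 * (i - 1) := by
  rcases Nat.eq_zero_or_pos i with rfl | hi
  · have := norm_exp_I_mul_sub_one_sub_le_two_mul_sq (l * x * ((0 : ℕ) - 1))
    refine this.trans (le_of_eq ?_)
    push_cast
    ring
  · have hi1 : (1 : ℝ) ≤ i := by exact_mod_cast hi
    set φ := (1 - x) ^ i - 1 + i * x
    have hφ : (i : ℝ) * (i - 1) * x ^ 2 / (2 * (1 + i * x)) ≤ φ :=
      div_le_bernoulli_remainder hx0 hx1 i
    have ht : 0 ≤ x * (i - 1) := mul_nonneg hx0 (by linarith)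
    have hB := norm_exp_I_mul_sub_one_sub_le_div l ht
    rw [← mul_assoc] at hB
    have h1 : (x * (i - 1)) ^ 2 / (1 + x * (i - 1)) ≤ 2 * φ := by
      have : (x * (i - 1)) ^ 2 / (1 + x * (i - 1)) ≤
          2 * ((i : ℝ) * (i - 1) * x ^ 2 / (2 * (1 + i * x))) := by
        have e : 2 * ((i : ℝ) * (i - 1) * x ^ 2 / (2 * (1 + i * x))) =
            (i : ℝ) * (i - 1) * x ^ 2 / (1 + i * x) := by field_simp
        rw [e, div_le_div_iff₀ (by positivity) (by positivity)]
        have : 0 ≤ ((i : ℝ) - 1) * x ^ 2 := mul_nonneg (by linarith) (sq_nonneg x)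
        nlinarith
      linarith
    have h2 : x ^ 2 * (i - 1) ≤ 4 * φ := by
      have : x ^ 2 * (i - 1) ≤ 4 * ((i : ℝ) * (i - 1) * x ^ 2 / (2 * (1 + i * x))) := by
        rw [← mul_div_assoc, le_div_iff₀ (by positivity)]
        have h0 : 0 ≤ ((i : ℝ) - 1) * x ^ 2 := mul_nonneg (by linarith) (sq_nonneg x)
        have h3 : 2 * (1 + i * x) ≤ 4 * (i : ℝ) := by nlinarith
        nlinarith [mul_le_mul_of_nonneg_left h3 h0]
      linarith
    have h3 := mul_le_mul_of_nonneg_left h1 (show 0 ≤ 2 * l ^ 2 + 2 * |l| by positivity)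
    have h4 := mul_le_mul_of_nonneg_left h2 (show 0 ≤ 2 * l ^ 2 by positivity)
    linarith

lemma norm_exp_remainder_le (l : ℝ) {x : ℝ} (hx0 : 0 ≤ x) (hx1 : x ≤ 1) (i : ℕ) :
    ‖Complex.exp (Complex.I * (l * x * i : ℝ)) - 1 - Complex.I * (l * x * i : ℝ)‖ ≤
      4 * (2 * l ^ 2 + 2 * |l|) * ((1 - x) ^ i - 1 + i * x) + 2 * l ^ 2 * x ^ 2 := by
  obtain rfl | rfl | hi : i = 0 ∨ i = 1 ∨ 2 ≤ i := by omega
  · simp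
    positivity
  · have := norm_exp_I_mul_sub_one_sub_le_two_mul_sq (l * x * (1 : ℕ))
    refine this.trans (le_of_eq ?_)
    push_cast
    ring
  · have hi2 : (2 : ℝ) ≤ i := by exact_mod_cast hi
    set φ := (1 - x) ^ i - 1 + i * x
    have hφ : (i : ℝ) * (i - 1) * x ^ 2 / (2 * (1 + i * x)) ≤ φ :=
      div_le_bernoulli_remainder hx0 hx1 i
    have ht : 0 ≤ x * i := by positivity
    have hB := norm_exp_I_mul_sub_one_sub_le_div l ht
    rw [← mul_assoc] at hB
    have h1 : (x * i) ^ 2 / (1 + x * i) ≤ 4 * φ := by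
      have : (x * i) ^ 2 / (1 + x * i) ≤
          4 * ((i : ℝ) * (i - 1) * x ^ 2 / (2 * (1 + i * x))) := by
        have e : 4 * ((i : ℝ) * (i - 1) * x ^ 2 / (2 * (1 + i * x))) =
            2 * (i : ℝ) * (i - 1) * x ^ 2 / (1 + x * i) := by field_simp; ring
        rw [e]
        gcongr
        nlinarith [mul_nonneg (sq_nonneg x) (show (0 : ℝ) ≤ i * (i - 2) from
          mul_nonneg (by linarith) (by linarith))]
      linarith
    have h3 := mul_le_mul_of_nonneg_left h1 (show 0 ≤ 2 * l ^ 2 + 2 * |l| by positivity)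
    have h4 : 0 ≤ 2 * l ^ 2 * x ^ 2 := by positivity
    linarith

section PGF

variable {p : ℕ → ℝ}

lemma hasSum_bernoulli_remainder (hp0 : ∀ i, 0 ≤ p i) (hp1 : HasSum p 1)
    (hpm : Summable fun i : ℕ => (i : ℝ) * p i) {x : ℝ} (hx0 : 0 ≤ x) (hx1 : x ≤ 1) :
    HasSum (fun i : ℕ => p i * ((1 - x) ^ i - 1 + i * x))
      (pgf p (1 - x) - 1 + pgfMean p * x) := by
  have hg : HasSum (fun i => p i * (1 - x) ^ i) (pgf p (1 - x)) := by
    refine (Summable.of_nonneg_of_le (fun i => ?_) (fun i => ?_) hp1.summable).hasSum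
    · exact mul_nonneg (hp0 i) (pow_nonneg (by linarith) i)
    · exact mul_le_of_le_one_right (hp0 i) (pow_le_one₀ (by linarith) (by linarith))
  have e : (fun i : ℕ => p i * ((1 - x) ^ i - 1 + i * x)) =
      fun i : ℕ => p i * (1 - x) ^ i - p i + i * p i * x := by
    funext i
    ring
  rw [e]
  exact (hg.sub hp1).add (hpm.hasSum.mul_right x)

lemma hasSum_cpgf (hp0 : ∀ i, 0 ≤ p i) (hp1 : HasSum p 1) (u : ℝ) :
    HasSum (fun i => (p i : ℂ) * Complex.exp (Complex.I * u) ^ i)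
      (cpgf p (Complex.exp (Complex.I * u))) := by
  refine (Summable.of_norm_bounded hp1.summable fun i => ?_).hasSum
  rw [norm_mul, norm_pow, mul_comm Complex.I, Complex.norm_exp_ofReal_mul_I]
  simp [abs_of_nonneg (hp0 i)]

lemma hasSum_ofReal_mean (hpm : Summable fun i : ℕ => (i : ℝ) * p i) :
    HasSum (fun i : ℕ => (i : ℂ) * (p i : ℂ)) (pgfMean p : ℂ) := by
  have := Complex.hasSum_ofReal.mpr hpm.hasSum
  simpa [pgfMean] using this

lemma norm_cpgf_centered_remainder_le (hp0 : ∀ i, 0 ≤ p i) (hp1 : HasSum p 1)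
    (hpm : Summable fun i : ℕ => (i : ℝ) * p i) {x : ℝ} (hx0 : 0 ≤ x) (hx1 : x ≤ 1) (l : ℝ) :
    ‖Complex.exp (-(Complex.I * (l * x : ℝ))) * cpgf p (Complex.exp (Complex.I * (l * x : ℝ))) - 1
        - Complex.I * (l * x : ℝ) * (pgfMean p - 1 : ℝ)‖ ≤
      (2 * (2 * l ^ 2 + 2 * |l|) + 8 * l ^ 2) * (pgf p (1 - x) - 1 + pgfMean p * x) -
        2 * l ^ 2 * x ^ 2 * (pgfMean p - 1) := by
  have hp1' : HasSum (fun i => (p i : ℂ)) 1 := by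
    simpa using Complex.hasSum_ofReal.mpr hp1
  have hL := (((hasSum_cpgf hp0 hp1 (l * x)).mul_left
    (Complex.exp (-(Complex.I * (l * x : ℝ))))).sub hp1').sub
      (((hasSum_ofReal_mean hpm).sub hp1').mul_left (Complex.I * (l * x : ℝ)))
  have hR := ((hasSum_bernoulli_remainder hp0 hp1 hpm hx0 hx1).mul_left
    (2 * (2 * l ^ 2 + 2 * |l|) + 8 * l ^ 2)).sub
      ((hpm.hasSum.sub hp1).mul_left (2 * l ^ 2 * x ^ 2))
  have key := hL.norm_le_of_bounded hR fun i => ?_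
  · simpa [pgfMean] using key
  · have e : Complex.exp (-(Complex.I * (l * x : ℝ))) *
          ((p i : ℂ) * Complex.exp (Complex.I * (l * x : ℝ)) ^ i) - p i -
          Complex.I * (l * x : ℝ) * (i * p i - p i) =
        p i * (Complex.exp (Complex.I * (l * x * (i - 1) : ℝ)) - 1 -
          Complex.I * (l * x * (i - 1) : ℝ)) := by
      have h : Complex.exp (Complex.I * (l * x * (i - 1) : ℝ)) =
          Complex.exp (-(Complex.I * (l * x : ℝ))) * Complex.exp (Complex.I * (l * x : ℝ)) ^ i := by
        rw [← Complex.exp_nat_mul, ← Complex.exp_add]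
        congr 1
        push_cast
        ring
      rw [h]
      push_cast
      ring
    rw [e, norm_mul, Complex.norm_real, Real.norm_of_nonneg (hp0 i)]
    have := mul_le_mul_of_nonneg_left (norm_exp_centered_remainder_le l hx0 hx1 i) (hp0 i)
    linarith

lemma norm_cpgf_remainder_le (hp0 : ∀ i, 0 ≤ p i) (hp1 : HasSum p 1)
    (hpm : Summable fun i : ℕ => (i : ℝ) * p i) {x : ℝ} (hx0 : 0 ≤ x) (hx1 : x ≤ 1) (l : ℝ) :
    ‖cpgf p (Complex.exp (Complex.I * (l * x : ℝ))) - 1 -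
        Complex.I * (l * x : ℝ) * (pgfMean p : ℝ)‖ ≤
      4 * (2 * l ^ 2 + 2 * |l|) * (pgf p (1 - x) - 1 + pgfMean p * x) + 2 * l ^ 2 * x ^ 2 := by
  have hp1' : HasSum (fun i => (p i : ℂ)) 1 := by
    simpa using Complex.hasSum_ofReal.mpr hp1
  have hL := ((hasSum_cpgf hp0 hp1 (l * x)).sub hp1').sub
      ((hasSum_ofReal_mean hpm).mul_left (Complex.I * (l * x : ℝ)))
  have hR := ((hasSum_bernoulli_remainder hp0 hp1 hpm hx0 hx1).mul_left
    (4 * (2 * l ^ 2 + 2 * |l|))).add (hp1.mul_left (2 * l ^ 2 * x ^ 2))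
  have key := hL.norm_le_of_bounded hR fun i => ?_
  · simpa using key
  · have e : (p i : ℂ) * Complex.exp (Complex.I * (l * x : ℝ)) ^ i - p i -
          Complex.I * (l * x : ℝ) * (i * p i) =
        p i * (Complex.exp (Complex.I * (l * x * i : ℝ)) - 1 -
          Complex.I * (l * x * i : ℝ)) := by
      have h : Complex.exp (Complex.I * (l * x * i : ℝ)) =
          Complex.exp (Complex.I * (l * x : ℝ)) ^ i := by
        rw [← Complex.exp_nat_mul]
        congr 1
        push_cast
        ring
      rw [h]
      push_cast
      ring
    rw [e, norm_mul, Complex.norm_real, Real.norm_of_nonneg (hp0 i)]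
    have := mul_le_mul_of_nonneg_left (norm_exp_remainder_le l hx0 hx1 i) (hp0 i)
    linarith

end PGF

lemma tendsto_inv_of_tendsto_natCast_div_sq {c : ℕ → ℝ} {γ₀ : ℝ}
    (hc : ∀ n, 0 < c n) (hC2 : Tendsto (fun n : ℕ => (n : ℝ) / c n ^ 2) atTop (𝓝 γ₀)) :
    Tendsto (fun n => (c n)⁻¹) atTop (𝓝 0) := by
  have h := (hC2.mul (tendsto_inv_atTop_nhds_zero_nat (𝕜 := ℝ))).sqrt
  rw [mul_zero, Real.sqrt_zero] at h
  refine h.congr' ?_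
  filter_upwards [eventually_gt_atTop 0] with n hn
  have hn' : (n : ℝ) ≠ 0 := by exact_mod_cast hn.ne'
  have e : (n : ℝ) / c n ^ 2 * (n : ℝ)⁻¹ = (c n)⁻¹ ^ 2 := by field_simp
  rw [e, Real.sqrt_sq (inv_nonneg.mpr (hc n).le)]

theorem stmt19
    (p q : ℕ → ℕ → ℝ)
    (hp0 : ∀ n i, 0 ≤ p n i) (hp1 : ∀ n, ∑' i, p n i = 1)
    (hq0 : ∀ n i, 0 ≤ q n i) (hq1 : ∀ n, ∑' i, q n i = 1)
    (hpm : ∀ n, Summable fun i : ℕ => (i : ℝ) * p n i)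
    (hqm : ∀ n, Summable fun i : ℕ => (i : ℝ) * q n i)
    (c : ℕ → ℝ) (hcpos : ∀ n, 0 < c n)
    (γ₀ a w : ℝ) (hγ₀ : 0 ≤ γ₀) (hw : 0 ≤ w)
    -- condition (C)
    (hC1 : Tendsto (fun n : ℕ => (n : ℝ) / c n) atTop atTop)
    (hC2 : Tendsto (fun n : ℕ => (n : ℝ) / c n ^ 2) atTop (𝓝 γ₀))
    -- condition (D1)
    (hD1 : Tendsto (fun n : ℕ => (n : ℝ) * (pgfMean (p n) - 1)) atTop (𝓝 a))
    -- condition (D2)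
    (G : ℝ → ℝ)
    (hGlip : ∀ M > (0 : ℝ), ∃ K : ℝ, ∀ (n : ℕ) (l l' : ℝ),
      l ∈ Set.Icc 0 M → l' ∈ Set.Icc 0 M → l ≤ c n → l' ≤ c n →
      |Gseq p c n l - Gseq p c n l'| ≤ K * |l - l'|)
    (hGlim : ∀ l : ℝ, 0 ≤ l → Tendsto (fun n => Gseq p c n l) atTop (𝓝 (G l)))
    (hGcont : ContinuousOn G (Set.Ici 0))
    -- condition (E1)
    (hE1 : Tendsto (fun n : ℕ => pgfMean (q n)) atTop (𝓝 w))
    -- condition (E2)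
    (H : ℝ → ℝ)
    (hHlip : ∀ M > (0 : ℝ), ∃ K : ℝ, ∀ (n : ℕ) (l l' : ℝ),
      l ∈ Set.Icc 0 M → l' ∈ Set.Icc 0 M → l ≤ c n → l' ≤ c n →
      |Hseq q c n l - Hseq q c n l'| ≤ K * |l - l'|)
    (hHlim : ∀ l : ℝ, 0 ≤ l → Tendsto (fun n => Hseq q c n l) atTop (𝓝 (H l)))
    (hHcont : ContinuousOn H (Set.Ici 0)) :
    ∀ l : ℝ,
      Tendsto (fun n : ℕ => (n : ℂ) *
          (Complex.exp (-(Complex.I * (l : ℂ) / (c n : ℂ))) *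
            cpgf (p n) (Complex.exp (Complex.I * (l : ℂ) / (c n : ℂ))) - 1))
        atTop (𝓝 0) ∧
      Tendsto (fun n : ℕ => ((Real.sqrt n : ℝ) : ℂ) *
          (cpgf (q n) (Complex.exp (Complex.I * (l : ℂ) / (c n : ℂ))) - 1))
        atTop (𝓝 (Complex.I * (w : ℂ) * ((Real.sqrt γ₀ : ℝ) : ℂ) * (l : ℂ))) := by
  intro l
  have hx := tendsto_inv_of_tendsto_natCast_div_sq hcpos hC2
  have hxle : ∀ᶠ n in atTop, (c n)⁻¹ ≤ 1 := hx.eventually_le_const one_pos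
  have hx0 : ∀ n, 0 ≤ (c n)⁻¹ := fun n => inv_nonneg.mpr (hcpos n).le
  have hinv := tendsto_inv_atTop_nhds_zero_nat (𝕜 := ℝ)
  have hsqrt : Tendsto (fun n : ℕ => √(n : ℝ) * (c n)⁻¹) atTop (𝓝 √γ₀) := by
    refine hC2.sqrt.congr fun n => ?_
    rw [Real.sqrt_div (Nat.cast_nonneg n), Real.sqrt_sq (hcpos n).le, div_eq_mul_inv]
  have hang : ∀ n, Complex.I * (l : ℂ) / (c n : ℂ) = Complex.I * (l * (c n)⁻¹ : ℝ) := by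
    intro n
    push_cast
    ring
  have hsum : ∀ r : ℕ → ℝ, ∑' i, r i = 1 → HasSum r 1 := by
    intro r hr
    rw [← hr]
    refine Summable.hasSum (by_contra fun h => ?_)
    simp [tsum_eq_zero_of_not_summable h] at hr
  constructor
  · have herr : Tendsto (fun n : ℕ => (n : ℂ) *
        (Complex.exp (-(Complex.I * (l * (c n)⁻¹ : ℝ))) *
          cpgf (p n) (Complex.exp (Complex.I * (l * (c n)⁻¹ : ℝ))) - 1 -
          Complex.I * (l * (c n)⁻¹ : ℝ) * (pgfMean (p n) - 1 : ℝ))) atTop (𝓝 0) := by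
      have hb := (((hGlim 1 zero_le_one).mul hinv).const_mul
        (-(2 * (2 * l ^ 2 + 2 * |l|) + 8 * l ^ 2))).sub
          (((hx.pow 2).mul hD1).const_mul (2 * l ^ 2))
      simp only [mul_zero, zero_mul, sub_zero, ne_eq, OfNat.ofNat_ne_zero, not_false_eq_true,
        zero_pow] at hb
      refine squeeze_zero_norm' ?_ hb
      filter_upwards [hxle, eventually_gt_atTop 0] with n hn hn0
      have hn' : (n : ℝ) ≠ 0 := by exact_mod_cast hn0.ne'
      rw [norm_mul, Complex.norm_natCast]
      refine (mul_le_mul_of_nonneg_left (norm_cpgf_centered_remainder_le (hp0 n)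
        (hsum _ (hp1 n)) (hpm n) (hx0 n) hn l) (Nat.cast_nonneg n)).trans (le_of_eq ?_)
      simp only [Gseq, mul_one, div_eq_mul_inv, one_mul]
      field_simp
      ring
    have hmain : Tendsto (fun n : ℕ => Complex.I *
        (l * (c n)⁻¹ * (n * (pgfMean (p n) - 1)) : ℝ)) atTop (𝓝 0) := by
      have h := (hx.const_mul l).mul hD1
      rw [mul_zero, zero_mul] at h
      simpa using (Complex.continuous_ofReal.tendsto 0 |>.comp h).const_mul Complex.I
    have h := herr.add hmain
    rw [add_zero] at h
    refine h.congr fun n => ?_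
    rw [hang]
    push_cast
    ring
  · have herr : Tendsto (fun n : ℕ => ((√(n : ℝ) : ℝ) : ℂ) *
        (cpgf (q n) (Complex.exp (Complex.I * (l * (c n)⁻¹ : ℝ))) - 1 -
          Complex.I * (l * (c n)⁻¹ : ℝ) * (pgfMean (q n) : ℝ))) atTop (𝓝 0) := by
      have hinv' : Tendsto (fun n : ℕ => √(n : ℝ) * (n : ℝ)⁻¹) atTop (𝓝 0) := by
        have h := hinv.sqrt
        rw [Real.sqrt_zero] at h
        refine h.congr fun n => ?_
        rw [← div_eq_mul_inv, Real.sqrt_div_self, Real.sqrt_inv]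
      have hb := (((hHlim 1 zero_le_one).mul hinv').const_mul
        (-(4 * (2 * l ^ 2 + 2 * |l|)))).add ((hsqrt.mul hx).const_mul (2 * l ^ 2))
      simp only [mul_zero, add_zero] at hb
      refine squeeze_zero_norm' ?_ hb
      filter_upwards [hxle, eventually_gt_atTop 0] with n hn hn0
      have hn' : (n : ℝ) ≠ 0 := by exact_mod_cast hn0.ne'
      rw [norm_mul, Complex.norm_real, Real.norm_of_nonneg (Real.sqrt_nonneg _)]
      refine (mul_le_mul_of_nonneg_left (norm_cpgf_remainder_le (hq0 n)
        (hsum _ (hq1 n)) (hqm n) (hx0 n) hn l) (Real.sqrt_nonneg _)).trans (le_of_eq ?_)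
      simp only [Hseq, mul_one, div_eq_mul_inv, one_mul]
      field_simp
      ring
    have hmain : Tendsto (fun n : ℕ => Complex.I *
        (√(n : ℝ) * (c n)⁻¹ * l * pgfMean (q n) : ℝ)) atTop
        (𝓝 (Complex.I * (√γ₀ * l * w : ℝ))) :=
      (Complex.continuous_ofReal.tendsto _ |>.comp ((hsqrt.mul_const l).mul hE1)).const_mul _
    have h := herr.add hmain
    rw [zero_add] at h
    convert h using 2 with n
    · rw [hang]
      push_cast
      ring
    · push_cast
      ring
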